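/- Let N ≥ 2 and 0 < μ < (N-2s)/2 with s ∈ (0,1) (in particular 0 < μ < N-1). Then there exists a constant K > 0 such that for every radial f ∈ L¹(ℝ^N) and every x ∈ ℝ^N \ {0}, ∫_{ℝ^N} |f(y)| / |x-y|^μ dy ≤ K |x|^{-μ} ∫_{ℝ^N} |f(y)| dy. -/

import Mathlib

open MeasureTheory

namespace RKE

open Metric Set

lemma polar {E : Type*} [NormedAddCommGroup E] [NormedSpace ℝ E] [MeasurableSpace E]
    [BorelSpace E] [FiniteDimensional ℝ E] [Nontrivial E] (ν : Measure E) [ν.IsAddHaarMeasure]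
    (F : ℝ → ENNReal) (G : E → ENNReal) (hG : Measurable G)
    (hG0 : ∀ (r : ℝ) (y : E), 0 < r → G (r • y) = G y)
    (hF : AEMeasurable (fun y : E => F ‖y‖) ν) :
    ∫⁻ y, G y * F ‖y‖ ∂ν = (∫⁻ w : sphere (0:E) 1, G w ∂ν.toSphere) *
      ∫⁻ r : Ioi (0:ℝ), F r ∂(Measure.volumeIoiPow (Module.finrank ℝ E - 1)) := by
  have mp := ν.measurePreserving_homeomorphUnitSphereProd
  have emb := (homeomorphUnitSphereProd E).measurableEmbedding
  have h1 : AEMeasurable (fun p : sphere (0:E) 1 × Ioi (0:ℝ) => F p.2)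
      (ν.toSphere.prod (Measure.volumeIoiPow (Module.finrank ℝ E - 1))) := by
    rw [← mp.aemeasurable_comp_iff emb]
    have : AEMeasurable (fun y : E => F ‖y‖) (ν.restrict ({0}ᶜ)) := hF.restrict
    rw [← map_comap_subtype_coe (measurableSet_singleton _).compl] at this
    have h2 := this.comp_measurable (measurable_subtype_coe)
    refine h2.congr (.of_forall fun y => ?_)
    simp
  have h2 : AEMeasurable (fun r : Ioi (0:ℝ) => F r)
      (Measure.volumeIoiPow (Module.finrank ℝ E - 1)) := by
    refine (AEStronglyMeasurable.of_comp_snd (f := fun r : Ioi (0:ℝ) => F r)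
      h1.aestronglyMeasurable (by simp)).aemeasurable
  rw [← lintegral_prod_mul (f := fun w : sphere (0:E) 1 => G w) (hG.comp measurable_subtype_coe).aemeasurable h2,
    ← mp.lintegral_comp_emb emb, ← restrict_compl_singleton (μ := ν) 0,
    ← lintegral_subtype_comap (measurableSet_singleton (0:E)).compl, restrict_compl_singleton]
  refine lintegral_congr fun y => ?_
  have hy : (0:ℝ) < ‖(y:E)‖⁻¹ := inv_pos.2 (norm_pos_iff.2 y.2)
  simp [hG0 _ _ hy]

variable {N : ℕ}

local notation "EN" => EuclideanSpace ℝ (Fin N)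

noncomputable def g (b : Fin N → ℝ) (y : EN) : ℝ := ∏ j, (|y j| / ‖y‖) ^ (-(b j))

lemma g_meas (b : Fin N → ℝ) : Measurable (g b) := by
  unfold g
  refine Finset.measurable_prod _ fun j _ => ?_
  refine Measurable.pow_const ?_ _
  refine Measurable.div ?_ measurable_norm
  have : Measurable (fun y : EN => y j) := by fun_prop
  exact this.abs

lemma g_hom (b : Fin N → ℝ) (r : ℝ) (y : EN) (hr : 0 < r) : g b (r • y) = g b y := by
  unfold g
  refine Finset.prod_congr rfl fun j _ => ?_
  simp only [PiLp.smul_apply, smul_eq_mul, abs_mul, norm_smul, Real.norm_eq_abs]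
  rw [mul_div_mul_left _ _ (abs_pos.2 hr.ne').ne']

lemma int1 (a : ℝ) (ha : a < 1) :
    IntegrableOn (fun t : ℝ => |t| ^ (-a)) (ball (0:ℝ) 2) := by
  have := integrableOn_fun_norm_addHaar (E := ℝ) (volume) (f := fun t : ℝ => t ^ (-a)) (r := 2)
  simp only [Real.norm_eq_abs] at this
  rw [this]
  simp only [Module.finrank_self, Nat.sub_self, pow_zero, one_smul]
  have h := intervalIntegral.intervalIntegrable_rpow' (a := 0) (b := 2) (r := -a) (by linarith)
  rw [intervalIntegrable_iff_integrableOn_Ioo_of_le (by norm_num)] at h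
  exact h

lemma ae_ne : ∀ᵐ y : EN, ∀ j, y j ≠ 0 := by
  have h : ∀ᵐ y : Fin N → ℝ, ∀ j, y j ≠ 0 := by
    rw [ae_all_iff]
    intro j
    have := (Measure.quasiMeasurePreserving_eval (μ := fun _ : Fin N => (volume : Measure ℝ)) j).ae
      (p := fun t => t ≠ 0) (Measure.ae_ne _ _)
    exact this
  exact (PiLp.volume_preserving_ofLp (Fin N)).quasiMeasurePreserving.ae h

lemma g_int (b : Fin N → ℝ) (hb0 : ∀ j, 0 ≤ b j) (hb : ∀ j, b j < 1) :
    ∫⁻ y : EN in ball 0 1, ENNReal.ofReal (g b y) < ⊤ := by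
  have h := Integrable.fintype_prod (𝕜 := ℝ) (ι := Fin N) (μ := fun _ => (volume : Measure ℝ))
    (f := fun j => (ball (0:ℝ) 2).indicator (fun t : ℝ => |t| ^ (-(b j))))
    (fun j => (integrable_indicator_iff measurableSet_ball).2 (int1 (b j) (hb j)))
  have h' := (PiLp.volume_preserving_ofLp (Fin N)).integrable_comp_of_integrable h
  refine lt_of_le_of_lt ?_ h'.2
  rw [← lintegral_indicator measurableSet_ball]
  refine lintegral_mono_ae ?_
  filter_upwards [ae_ne] with y hy
  by_cases h1 : y ∈ ball (0 : EN) 1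
  · rw [indicator_of_mem h1, ← ofReal_norm]
    refine ENNReal.ofReal_le_ofReal (le_trans ?_ (Real.le_norm_self _))
    have hy1 : ‖y‖ < 1 := by simpa using h1
    refine Finset.prod_le_prod (fun j _ => by positivity) fun j _ => ?_
    have hj : |y j| ≤ ‖y‖ := by simpa using PiLp.norm_apply_le y j
    have hj0 : 0 < |y j| := abs_pos.2 (hy j)
    rw [indicator_of_mem (by simpa using by linarith)]
    refine Real.rpow_le_rpow_of_nonpos hj0 ?_ (by linarith [hb0 j])
    rw [le_div_iff₀ (by linarith)]
    nlinarith
  · rw [indicator_of_notMem h1]; exact zero_le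

lemma det_le (i j : Fin N) (hij : j ≠ i) (ρ : ℝ) (hρ : 0 < ρ) (y : EN) :
    ρ * |y j| ≤ ‖EuclideanSpace.single i ρ - y‖ * ‖y‖ := by
  have key : ∀ z : EN, z i ^ 2 + z j ^ 2 ≤ ‖z‖ ^ 2 := by
    intro z
    rw [EuclideanSpace.real_norm_sq_eq, ← Finset.sum_pair (f := fun k => z k ^ 2) hij.symm]
    exact Finset.sum_le_sum_of_subset_of_nonneg (Finset.subset_univ _)
      (fun _ _ _ => by positivity)
  have h1 := key (EuclideanSpace.single i ρ - y)
  have h2 := key y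
  simp [hij] at h1
  refine abs_le_of_sq_le_sq' ?_ (by positivity) |>.2
  rw [mul_pow, mul_pow, sq_abs]
  have h3 : ρ ^ 2 * y j ^ 2 ≤ ((ρ - y i) ^ 2 + y j ^ 2) * (y i ^ 2 + y j ^ 2) := by
    nlinarith [sq_nonneg ((ρ - y i) * y i - y j ^ 2)]
  exact h3.trans (by gcongr)

lemma pt (b : Fin N → ℝ) (i : Fin N) (hbi : b i = 0) (hb0 : ∀ j, 0 ≤ b j) (μ : ℝ)
    (hs : ∑ j, b j = μ) (hμ : 0 < μ) (ρ : ℝ) (hρ : 0 < ρ) (y : EN) (hy : ∀ j, y j ≠ 0) :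
    1 / ‖EuclideanSpace.single i ρ - y‖ ^ μ ≤ ρ ^ (-μ) * g b y := by
  have hy0 : 0 < ‖y‖ := lt_of_lt_of_le (abs_pos.2 (hy i)) (by simpa using PiLp.norm_apply_le y i)
  set t := ‖EuclideanSpace.single i ρ - y‖ with ht
  rcases (norm_nonneg (EuclideanSpace.single i ρ - y)).eq_or_lt with h0 | h0
  · rw [← ht] at h0
    rw [← h0, Real.zero_rpow hμ.ne']
    simp only [div_zero]
    exact mul_nonneg (by positivity) (Finset.prod_nonneg fun j _ => by positivity)
  rw [← ht] at h0
  have : (t / ρ) ^ (-μ) ≤ g b y := by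
    rw [← hs, ← Finset.sum_neg_distrib, Real.rpow_sum_of_pos (by positivity)]
    refine Finset.prod_le_prod (fun j _ => by positivity) fun j _ => ?_
    by_cases hj : j = i
    · subst hj; simp [hbi]
    · have hj0 := abs_pos.2 (hy j)
      refine Real.rpow_le_rpow_of_nonpos (by positivity) ?_ (by linarith [hb0 j])
      rw [div_le_div_iff₀ hy0 hρ]
      linarith [det_le i j hj ρ hρ y]
  calc 1 / t ^ μ = ρ ^ (-μ) * (t / ρ) ^ (-μ) := by
        rw [← Real.mul_rpow hρ.le (by positivity), mul_div_cancel₀ _ hρ.ne', Real.rpow_neg h0.le,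
          one_div]
    _ ≤ _ := by gcongr

end RKE

open RKE in
theorem radial_kernel_estimate (N : ℕ) (s μ : ℝ) (hN : 2 ≤ N) (hs0 : 0 < s) (hs1 : s < 1)
    (hμ0 : 0 < μ) (hμ : μ < ((N : ℝ) - 2 * s) / 2) :
    ∃ K : ℝ, 0 < K ∧
      ∀ f : EuclideanSpace ℝ (Fin N) → ℝ, Integrable f volume →
        (∀ y y' : EuclideanSpace ℝ (Fin N), ‖y‖ = ‖y'‖ → f y = f y') →
        ∀ x : EuclideanSpace ℝ (Fin N), x ≠ 0 →
          ∫ y, |f y| / ‖x - y‖ ^ μ ≤ K * ‖x‖ ^ (-μ) * ∫ y, |f y| := by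
  have hN' : (2:ℝ) ≤ N := by exact_mod_cast hN
  let i : Fin N := ⟨0, by omega⟩
  have : Nonempty (Fin N) := ⟨i⟩
  let b : Fin N → ℝ := fun j => if j = i then 0 else μ / (N - 1)
  have hbi : b i = 0 := by simp [b]
  have hb0 : ∀ j, 0 ≤ b j := fun j => by
    simp only [b]; split_ifs
    · exact le_rfl
    · exact div_nonneg hμ0.le (by linarith)
  have hb1 : ∀ j, b j < 1 := fun j => by
    simp only [b]; split_ifs
    · exact one_pos
    · rw [div_lt_one (by linarith)]; linarith
  have hbs : ∑ j, b j = μ := by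
    have : ∀ j, b j = μ / (N - 1) - if j = i then μ / (N - 1) else 0 := fun j => by
      simp only [b]; split_ifs <;> simp
    simp_rw [this]
    rw [Finset.sum_sub_distrib]
    simp only [Finset.sum_const, Finset.card_univ, Fintype.card_fin, nsmul_eq_mul,
      Finset.sum_ite_eq', Finset.mem_univ, if_true]
    have : (N:ℝ) - 1 ≠ 0 := by linarith
    field_simp
  let G : EuclideanSpace ℝ (Fin N) → ENNReal := fun y => ENNReal.ofReal (g b y)
  have hGm : Measurable G := (g_meas b).ennreal_ofReal
  have hGh : ∀ (r : ℝ) (y : EuclideanSpace ℝ (Fin N)), 0 < r → G (r • y) = G y :=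
    fun r y hr => by simp only [G, g_hom b r y hr]
  set ν : Measure (EuclideanSpace ℝ (Fin N)) := volume with hν
  set C := ∫⁻ w : Metric.sphere (0:EuclideanSpace ℝ (Fin N)) 1, G w ∂ν.toSphere with hC
  set σ := ν.toSphere Set.univ with hσ
  have hσ0 : σ ≠ 0 := by rw [hσ, Ne, Measure.measure_univ_eq_zero]; simp
  have hσt : σ ≠ ⊤ := measure_ne_top _ _
  have pol : ∀ F : ℝ → ENNReal, AEMeasurable (fun y : EuclideanSpace ℝ (Fin N) => F ‖y‖) ν →
      ∫⁻ y, G y * F ‖y‖ ∂ν = C / σ * ∫⁻ y, F ‖y‖ ∂ν := by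
    intro F hF
    have h1 := polar ν F G hGm hGh hF
    have h2 := polar ν F (fun _ => 1) measurable_const (fun _ _ _ => rfl) hF
    simp only [one_mul, lintegral_const] at h2
    rw [h1, h2, ← mul_assoc, ENNReal.div_mul_cancel hσ0 hσt]
  have hfin : C / σ < ⊤ := by
    have h := pol ((Set.Iio 1).indicator 1)
      ((measurable_one.indicator measurableSet_Iio).comp measurable_norm).aemeasurable
    have e : (fun y : EuclideanSpace ℝ (Fin N) => (Set.Iio (1:ℝ)).indicator (1 : ℝ → ENNReal) ‖y‖)
        = (Metric.ball 0 1).indicator 1 := by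
      ext y; simp [Set.indicator]
    have e2 : (fun y : EuclideanSpace ℝ (Fin N) => G y * (Set.Iio (1:ℝ)).indicator (1 : ℝ → ENNReal) ‖y‖)
        = (Metric.ball 0 1).indicator G := by
      ext y; simp [Set.indicator]
    rw [e, e2, lintegral_indicator measurableSet_ball, lintegral_indicator_one measurableSet_ball] at h
    have h3 := g_int b hb0 hb1
    change ∫⁻ y in Metric.ball 0 1, G y ∂ν < ⊤ at h3
    rw [h] at h3
    by_contra hc
    rw [not_lt, top_le_iff] at hc
    rw [hc, ENNReal.top_mul (Metric.measure_ball_pos _ _ one_pos).ne'] at h3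
    exact lt_irrefl _ h3
  refine ⟨(C / σ).toReal + 1, by positivity, fun f hf hrad x hx => ?_⟩
  have hρ : 0 < ‖x‖ := norm_pos_iff.2 hx
  set x' : EuclideanSpace ℝ (Fin N) := EuclideanSpace.single i ‖x‖ with hx'
  have hrot : ∫ y, |f y| / ‖x - y‖ ^ μ ∂ν = ∫ y, |f y| / ‖x' - y‖ ^ μ ∂ν := by
    have hT := Submodule.reflection_sub (v := x) (w := x') (by simp [hx'])
    set T := (Submodule.span ℝ {x - x'})ᗮ.reflection
    rw [← T.measurePreserving.integral_comp T.toHomeomorph.measurableEmbedding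
      (fun y => |f y| / ‖x' - y‖ ^ μ)]
    refine integral_congr_ae (.of_forall fun y => ?_)
    simp only
    rw [← hT, ← map_sub, LinearIsometryEquiv.norm_map,
      hrad (T y) y (LinearIsometryEquiv.norm_map _ _)]
  rw [hrot]
  have hnn : 0 ≤ ∫ y, |f y| ∂ν := integral_nonneg fun _ => abs_nonneg _
  have main : ‖∫ y, |f y| / ‖x' - y‖ ^ μ ∂ν‖ₑ ≤
      ENNReal.ofReal (‖x‖ ^ (-μ)) * (C / σ * ∫⁻ y, ‖f y‖ₑ ∂ν) := by
    let F : ℝ → ENNReal := fun r => ‖f (EuclideanSpace.single i r)‖ₑ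
    have hF : ∀ y, F ‖y‖ = ‖f y‖ₑ := fun y => by
      simp only [F]; rw [hrad _ y (by simp)]
    have hp := pol F (by simp_rw [hF]; exact hf.1.enorm)
    simp_rw [hF] at hp
    rw [← hp, ← lintegral_const_mul' _ _ ENNReal.ofReal_ne_top]
    refine (enorm_integral_le_lintegral_enorm _).trans (lintegral_mono_ae ?_)
    filter_upwards [ae_ne] with y hy
    have hg0 : 0 ≤ g b y := Finset.prod_nonneg fun j _ => by positivity
    have hpt := pt b i hbi hb0 μ hbs hμ0 ‖x‖ hρ y hy
    rw [← ofReal_norm, ← ofReal_norm, ← mul_assoc,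
      ← ENNReal.ofReal_mul (by positivity),
      ← ENNReal.ofReal_mul (mul_nonneg (by positivity)
        hg0)]
    refine ENNReal.ofReal_le_ofReal ?_
    rw [Real.norm_of_nonneg (by positivity), div_eq_mul_one_div, mul_comm, Real.norm_eq_abs]
    gcongr
  have hfi : ∫⁻ y, ‖f y‖ₑ ∂ν ≠ ⊤ := hf.2.ne
  have m2 := ENNReal.toReal_mono (ENNReal.mul_ne_top ENNReal.ofReal_ne_top (ENNReal.mul_ne_top hfin.ne hfi)) main
  rw [toReal_enorm, ENNReal.toReal_mul, ENNReal.toReal_mul, ENNReal.toReal_ofReal (by positivity),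
    ← integral_norm_eq_lintegral_enorm hf.1] at m2
  simp only [Real.norm_eq_abs] at m2
  refine (le_abs_self _).trans (m2.trans ?_)
  have : 0 ≤ ‖x‖ ^ (-μ) * ∫ y, |f y| ∂ν := mul_nonneg (by positivity) hnn
  nlinarith
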